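/- arXiv:1510.04318 — 2 statements merged into one kernel-verified Lean document; each statement's English description precedes it below -/
import Mathlib

section
/- The operator R(x;φ) is unitary: for all x ∈ ℂ and φ ∈ ℂ³ that are admissible for this identity, R(x;φ) ∘ R(−x;φ) = Id on V ⊗ V. -/
noncomputable section

open Complex

/-- `p^w := exp(w · log p)` for a real base `p` and complex exponent `w`. -/
def pPow (p : ℝ) (w : ℂ) : ℂ := Complex.exp (w * (Real.log p : ℂ))

/-- The renormalised Jacobi theta function
`θ(z;p) = ∏_{m=0}^∞ (1 − p^m z)(1 − p^{m+1}/z)`. -/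
def theta (p : ℝ) (z : ℂ) : ℂ :=
  ∏' m : ℕ, ((1 - (p : ℂ) ^ m * z) * (1 - (p : ℂ) ^ (m + 1) / z))

/-- `A^y(x)`. -/
def Afun (p : ℝ) (κ y x : ℂ) : ℂ :=
  (theta p (pPow p (2 * κ)) * theta p (pPow p (y - x)) /
      (theta p (pPow p y) * theta p (pPow p (2 * κ - x)))) *
    pPow p ((2 * κ - y) * x)

/-- `B^y(x)`. -/
def Bfun (p : ℝ) (κ y x : ℂ) : ℂ :=
  (theta p (pPow p (2 * κ - y)) * theta p (pPow p (-x)) /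
      (theta p (pPow p (2 * κ - x)) * theta p (pPow p (-y)))) *
    pPow p (2 * κ * (x - y))

/-- The elliptic `c`-function `c(x) = p^{2κx} θ(p^{2κ+x};p)/θ(p^x;p)`. -/
def cfun (p : ℝ) (κ x : ℂ) : ℂ :=
  pPow p (2 * κ * x) * theta p (pPow p (2 * κ + x)) / theta p (pPow p x)

/-- `(−1)^{p(i)}` for the parity map `p(1)=p(2)=0`, `p(3)=1` (indices `0,1,2` in Lean). -/
def sgn3 (i : Fin 3) : ℂ := if i = 2 then -1 else 1

/-- The matrix of the elliptic dynamical `R`-operator `R(x;φ)` on `V ⊗ V`, `V = ℂ³`,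
with respect to the basis `v_i ⊗ v_j` (the pair `(i,j)` indexes the column, i.e. the input):
`R(x;φ)(v_i ⊗ v_i) = (−1)^{p(i)} (c(x)/c((−1)^{p(i)}x)) v_i ⊗ v_i` and, for `i ≠ j`,
`R(x;φ)(v_i ⊗ v_j) = A^{φ_i−φ_j}(x) v_i ⊗ v_j + (−1)^{p(i)+p(j)} B^{φ_i−φ_j}(x) v_j ⊗ v_i`. -/
def Rop (p : ℝ) (κ x : ℂ) (φ : Fin 3 → ℂ) :
    Matrix (Fin 3 × Fin 3) (Fin 3 × Fin 3) ℂ := fun ab ij =>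
  if ij.1 = ij.2 then
    (if ab = ij then sgn3 ij.1 * (cfun p κ x / cfun p κ (sgn3 ij.1 * x)) else 0)
  else
    (if ab = ij then Afun p κ (φ ij.1 - φ ij.2) x else 0) +
      (if ab = (ij.2, ij.1) then sgn3 ij.1 * sgn3 ij.2 * Bfun p κ (φ ij.1 - φ ij.2) x else 0)

/-- Admissibility of the parameters `(x,φ)` for the operator `R(x;φ)`: every theta-function
factor occurring in a denominator of an entry of `R(x;φ)` is nonzero. -/
def RAdm (p : ℝ) (κ x : ℂ) (φ : Fin 3 → ℂ) : Prop :=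
  theta p (pPow p x) ≠ 0 ∧ theta p (pPow p (2 * κ + x)) ≠ 0 ∧
    theta p (pPow p (2 * κ - x)) ≠ 0 ∧
    ∀ i j : Fin 3, i ≠ j → theta p (pPow p (φ i - φ j)) ≠ 0

section ThetaSeries

open Filter Topology

theorem pPow_add (p : ℝ) (a b : ℂ) : pPow p (a + b) = pPow p a * pPow p b := by
  simp only [pPow, add_mul, Complex.exp_add]

theorem pPow_zero (p : ℝ) : pPow p 0 = 1 := by simp [pPow]

theorem pPow_ne_zero (p : ℝ) (a : ℂ) : pPow p a ≠ 0 := Complex.exp_ne_zero _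

theorem pPow_neg (p : ℝ) (a : ℂ) : pPow p (-a) = (pPow p a)⁻¹ := by
  simp only [pPow, neg_mul, Complex.exp_neg]

theorem pPow_sub (p : ℝ) (a b : ℂ) : pPow p (a - b) = pPow p a / pPow p b := by
  rw [sub_eq_add_neg, pPow_add, pPow_neg, div_eq_mul_inv]

theorem pPow_intCast {p : ℝ} (hp0 : 0 < p) (k : ℤ) : pPow p k = (p : ℂ) ^ k := by
  rw [pPow, Complex.exp_int_mul, ← Complex.ofReal_exp, Real.exp_log hp0]

/-- The general term of the Laurent series of the theta function at `p ^ w`. -/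
def thetaTerm (p : ℝ) (w : ℂ) (j : ℤ) : ℂ :=
  (-1) ^ j * pPow p (j * (j - 1) / 2 + j * w)

/-- The Laurent series of the theta function at `p ^ w`, up to normalisation. -/
def thetaSeries (p : ℝ) (w : ℂ) : ℂ := ∑' j : ℤ, thetaTerm p w j

theorem thetaTerm_add_one {p : ℝ} (hp0 : 0 < p) (w : ℂ) (j : ℤ) :
    thetaTerm p w (j + 1) = -((p : ℂ) ^ j * pPow p w) * thetaTerm p w j := by
  rw [thetaTerm, thetaTerm, ← pPow_intCast hp0, zpow_add_one₀ (by norm_num),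
    show (((j + 1 : ℤ) : ℂ) * (((j + 1 : ℤ) : ℂ) - 1) / 2 + ((j + 1 : ℤ) : ℂ) * w) =
      j + w + (j * (j - 1) / 2 + j * w) by push_cast; ring, pPow_add, pPow_add]
  ring

/-- Gaussian series over `ℤ` converge absolutely. -/
theorem summable_pPow_quadratic {p : ℝ} (hp0 : 0 < p) (hp1 : p < 1) {a : ℝ} (ha : 0 < a)
    (b : ℂ) : Summable fun j : ℤ => ‖pPow p (a * j ^ 2 + b * j)‖ := by
  have hl : Real.log p < 0 := Real.log_neg hp0 hp1
  have hpi : (Real.pi : ℂ) ≠ 0 := Complex.ofReal_ne_zero.mpr Real.pi_ne_zero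
  refine Summable.norm ?_
  have h := (summable_jacobiTheta₂_term_iff (b * Real.log p / (2 * Real.pi * I))
    (((-(a * Real.log p) / Real.pi : ℝ) : ℂ) * I)).mpr (by
      rw [Complex.im_ofReal_mul, Complex.I_im, mul_one]
      exact div_pos (neg_pos.mpr (mul_neg_of_pos_of_neg ha hl)) Real.pi_pos)
  refine h.congr fun j => ?_
  rw [jacobiTheta₂_term, pPow]
  congr 1
  push_cast
  field_simp
  linear_combination (-(j : ℂ) ^ 2 * Real.log p * a) * I_sq

theorem summable_norm_thetaTerm {p : ℝ} (hp0 : 0 < p) (hp1 : p < 1) (w : ℂ) :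
    Summable fun j : ℤ => ‖thetaTerm p w j‖ := by
  refine (summable_pPow_quadratic hp0 hp1 (a := 1 / 2) (by norm_num) (w - 1 / 2)).congr fun j => ?_
  rw [thetaTerm, norm_mul, norm_zpow, norm_neg, norm_one, one_zpow, one_mul]
  congr 2
  push_cast
  ring

theorem thetaSeries_neg (p : ℝ) (w : ℂ) :
    thetaSeries p (-w) = -(pPow p (-w)) * thetaSeries p w := by
  rw [thetaSeries, thetaSeries, ← tsum_mul_left, ← (Equiv.subLeft (1 : ℤ)).tsum_eq]
  refine tsum_congr fun j => ?_
  rw [Equiv.subLeft_apply, thetaTerm, thetaTerm, zpow_sub₀ (by norm_num), zpow_one,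
    show (((1 - j : ℤ) : ℂ) * (((1 - j : ℤ) : ℂ) - 1) / 2 + ((1 - j : ℤ) : ℂ) * -w) =
      -w + (j * (j - 1) / 2 + j * w) by push_cast; ring, pPow_add]
  rcases Int.even_or_odd j with h | h
  · simp [h.neg_one_zpow]
  · simp [h.neg_one_zpow]

/-- Finite products `∏ (1 - p ^ (i + 1))`. -/
def eulerProd (p : ℝ) (n : ℕ) : ℂ := ∏ i ∈ Finset.range n, (1 - (p : ℂ) ^ (i + 1))

/-- The reciprocal of `eulerProd`, extended by zero to negative integers. -/
def eulerProdInv (p : ℝ) (k : ℤ) : ℂ := if 0 ≤ k then (eulerProd p k.toNat)⁻¹ else 0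

theorem one_sub_pow_ne_zero {p : ℝ} (hp0 : 0 < p) (hp1 : p < 1) (i : ℕ) :
    (1 - (p : ℂ) ^ (i + 1)) ≠ 0 := by
  have : p ^ (i + 1) < 1 := pow_lt_one₀ hp0.le hp1 (by omega)
  rw [sub_ne_zero]
  exact_mod_cast this.ne'

theorem eulerProdInv_sub_one {p : ℝ} (hp0 : 0 < p) (hp1 : p < 1) (k : ℤ) :
    eulerProdInv p (k - 1) = (1 - (p : ℂ) ^ k) * eulerProdInv p k := by
  rcases lt_trichotomy k 0 with h | rfl | h
  · rw [eulerProdInv, eulerProdInv, if_neg (by omega), if_neg (by omega), mul_zero]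
  · simp [eulerProdInv]
  · obtain ⟨n, rfl⟩ : ∃ n : ℕ, k = (n + 1 : ℕ) := ⟨(k - 1).toNat, by omega⟩
    have := one_sub_pow_ne_zero hp0 hp1 n
    simp only [eulerProdInv, eulerProd, Nat.cast_nonneg, if_true, Int.toNat_natCast, zpow_natCast,
      show ((n + 1 : ℕ) : ℤ) - 1 = (n : ℕ) by push_cast; ring, Finset.prod_range_succ]
    rw [mul_inv, mul_comm, mul_assoc, inv_mul_cancel₀ this, mul_one]

theorem exists_tendsto_eulerProd {p : ℝ} (hp0 : 0 < p) (hp1 : p < 1) :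
    ∃ L : ℂ, L ≠ 0 ∧ Tendsto (eulerProd p) atTop (𝓝 L) := by
  have hs : Summable fun i : ℕ => ‖-(p : ℂ) ^ (i + 1)‖ := by
    simpa using (summable_nat_add_iff 1).mpr
      (summable_geometric_of_lt_one (norm_nonneg (p : ℂ)) (by simpa [abs_of_pos hp0] using hp1))
  refine ⟨∏' i : ℕ, (1 + -(p : ℂ) ^ (i + 1)), tprod_one_add_ne_zero_of_summable
    (fun i => ?_) hs, ?_⟩
  · simpa [sub_eq_add_neg] using one_sub_pow_ne_zero hp0 hp1 i
  · exact (multipliable_one_add_of_summable hs).hasProd.tendsto_prod_nat.congr fun n => by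
      simp [eulerProd, sub_eq_add_neg]

/-- The finite form of the Jacobi triple product identity. -/
theorem hasSum_finite_theta {p : ℝ} (hp0 : 0 < p) (hp1 : p < 1) (w : ℂ) (n : ℕ) :
    HasSum (fun j : ℤ => eulerProd p (2 * n) * eulerProdInv p (n + j) * eulerProdInv p (n - j) *
        thetaTerm p w j)
      (∏ m ∈ Finset.range n,
        ((1 - (p : ℂ) ^ m * pPow p w) * (1 - (p : ℂ) ^ (m + 1) / pPow p w))) := by
  induction n with
  | zero =>
    have h : ∀ j : ℤ, j ≠ 0 → eulerProd p (2 * 0) * eulerProdInv p ((0 : ℕ) + j) *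
        eulerProdInv p ((0 : ℕ) - j) * thetaTerm p w j = 0 := by
      intro j hj
      rcases lt_or_gt_of_ne hj with h | h
      · simp [eulerProdInv, show ¬ 0 ≤ j by omega]
      · simp [eulerProdInv, show ¬ j ≤ 0 by omega]
    simpa [eulerProd, eulerProdInv, thetaTerm, pPow_zero] using hasSum_single (0 : ℤ) h
  | succ n ih =>
    have hz := pPow_ne_zero p w
    have hp : (p : ℂ) ≠ 0 := Complex.ofReal_ne_zero.mpr hp0.ne'
    have h1 := (Equiv.subRight (1 : ℤ)).hasSum_iff.mpr ih
    have h2 := (Equiv.addRight (1 : ℤ)).hasSum_iff.mpr ih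
    have h := ((ih.mul_left (1 + (p : ℂ) ^ (2 * n + 1))).sub
      (h1.mul_left ((p : ℂ) ^ n * pPow p w))).sub
      (h2.mul_left ((p : ℂ) ^ (n + 1) * (pPow p w)⁻¹))
    rw [Finset.prod_range_succ]
    convert! h using 1
    · funext j
      have e0 : eulerProd p (2 * (n + 1)) = eulerProd p (2 * n) * (1 - (p : ℂ) ^ (2 * n + 1)) *
          (1 - (p : ℂ) ^ (2 * n + 2)) := by
        simp only [eulerProd, mul_add, mul_one, Finset.prod_range_succ]
      have t1 : thetaTerm p w j = -((p : ℂ) ^ (j - 1) * pPow p w) * thetaTerm p w (j - 1) := by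
        simpa using thetaTerm_add_one hp0 w (j - 1)
      have t2 := thetaTerm_add_one hp0 w j
      have a1 := eulerProdInv_sub_one hp0 hp1 (n + 1 + j)
      have a2 := eulerProdInv_sub_one hp0 hp1 (n + j)
      have b1 := eulerProdInv_sub_one hp0 hp1 (n + 1 - j)
      have b2 := eulerProdInv_sub_one hp0 hp1 (n - j)
      have hpj : (p : ℂ) ^ j ≠ 0 := zpow_ne_zero _ hp
      have hpn : (p : ℂ) ^ n ≠ 0 := pow_ne_zero _ hp
      simp only [Function.comp, Equiv.subRight_apply, Equiv.coe_addRight]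
      rw [show (n : ℤ) + 1 + j - 1 = n + j by ring] at a1
      rw [show (n : ℤ) + 1 - j - 1 = n - j by ring] at b1
      rw [e0, t2, show ((n + 1 : ℕ) : ℤ) = (n : ℤ) + 1 by push_cast; ring,
        show (n : ℤ) + (j - 1) = n + j - 1 by ring, show (n : ℤ) - (j - 1) = n + 1 - j by ring,
        show (n : ℤ) + (j + 1) = n + 1 + j by ring, show (n : ℤ) - (j + 1) = n - j - 1 by ring,
        a2, b2, a1, b1]
      have t1' : pPow p w * thetaTerm p w (j - 1) = -((p : ℂ) / (p : ℂ) ^ j) * thetaTerm p w j := by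
        rw [t1, zpow_sub_one₀ hp]
        field_simp
      have t3 : (p : ℂ) ^ n * pPow p w * (eulerProd p (2 * n) *
          ((1 - (p : ℂ) ^ ((n : ℤ) + j)) * ((1 - (p : ℂ) ^ ((n : ℤ) + 1 + j)) *
            eulerProdInv p (n + 1 + j))) * eulerProdInv p (n + 1 - j) * thetaTerm p w (j - 1)) =
          (p : ℂ) ^ n * (eulerProd p (2 * n) *
          ((1 - (p : ℂ) ^ ((n : ℤ) + j)) * ((1 - (p : ℂ) ^ ((n : ℤ) + 1 + j)) *
            eulerProdInv p (n + 1 + j))) * eulerProdInv p (n + 1 - j) *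
            (-((p : ℂ) / (p : ℂ) ^ j) * thetaTerm p w j)) := by
        rw [← t1']; ring
      rw [t3]
      simp only [zpow_add₀ hp, zpow_sub₀ hp, zpow_natCast, zpow_one, pow_add, pow_mul, pow_one]
      field_simp
      ring
    · rw [div_eq_mul_inv]
      linear_combination ((∏ m ∈ Finset.range n,
        ((1 - (p : ℂ) ^ m * pPow p w) * (1 - (p : ℂ) ^ (m + 1) / pPow p w))) *
          (p : ℂ) ^ (2 * n + 1)) * mul_inv_cancel₀ hz

theorem tendsto_prod_theta {p : ℝ} (hp0 : 0 < p) (hp1 : p < 1) (z : ℂ) :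
    Tendsto (fun n => ∏ m ∈ Finset.range n, ((1 - (p : ℂ) ^ m * z) * (1 - (p : ℂ) ^ (m + 1) / z)))
      atTop (𝓝 (theta p z)) := by
  have hg : Summable fun i : ℕ => ‖(p : ℂ) ^ i‖ := by
    simpa using summable_geometric_of_lt_one (norm_nonneg (p : ℂ))
      (by simpa [abs_of_pos hp0] using hp1)
  have h1 : Multipliable fun m : ℕ => (1 + -((p : ℂ) ^ m * z)) :=
    multipliable_one_add_of_summable (by simpa using hg.mul_right ‖z‖)
  have h2 : Multipliable fun m : ℕ => (1 + -((p : ℂ) ^ (m + 1) / z)) :=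
    multipliable_one_add_of_summable
      (by simpa using ((summable_nat_add_iff 1).mpr hg).div_const ‖z‖)
  simp only [← sub_eq_add_neg] at h1 h2
  exact (h1.mul h2).hasProd.tendsto_prod_nat

/-- The Jacobi triple product identity, with an unspecified normalisation constant. -/
theorem exists_theta_eq_mul_thetaSeries {p : ℝ} (hp0 : 0 < p) (hp1 : p < 1) :
    ∃ C : ℂ, ∀ w, theta p (pPow p w) = C * thetaSeries p w := by
  obtain ⟨L, hL, hlim⟩ := exists_tendsto_eulerProd hp0 hp1
  obtain ⟨K, hK⟩ := hlim.norm.bddAbove_range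
  obtain ⟨M, hM⟩ := (hlim.inv₀ hL).norm.bddAbove_range
  have hK' : ∀ n, ‖eulerProd p n‖ ≤ K := fun n => hK ⟨n, rfl⟩
  have hM' : ∀ k, ‖eulerProdInv p k‖ ≤ M := fun k => by
    have h0 : ∀ n, ‖(eulerProd p n)⁻¹‖ ≤ M := fun n => hM ⟨n, rfl⟩
    rw [eulerProdInv]
    split_ifs
    · exact h0 _
    · simpa using (norm_nonneg _).trans (h0 0)
  have hinv : Tendsto (eulerProdInv p) atTop (𝓝 L⁻¹) := by
    have h : Tendsto Int.toNat atTop atTop :=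
      tendsto_atTop.mpr fun b => (eventually_ge_atTop (b : ℤ)).mono fun k hk => by omega
    refine ((hlim.inv₀ hL).comp h).congr' ?_
    filter_upwards [eventually_ge_atTop 0] with k hk
    simp [eulerProdInv, hk]
  refine ⟨L * L⁻¹ * L⁻¹, fun w => ?_⟩
  refine tendsto_nhds_unique (tendsto_prod_theta hp0 hp1 (pPow p w)) ?_
  simp_rw [fun n => (hasSum_finite_theta hp0 hp1 w n).tsum_eq.symm]
  rw [thetaSeries, ← tsum_mul_left]
  refine tendsto_tsum_of_dominated_convergence
    (bound := fun j => K * M * M * ‖thetaTerm p w j‖)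
    ((summable_norm_thetaTerm hp0 hp1 w).mul_left _) (fun j => ?_) (Eventually.of_forall ?_)
  · refine Tendsto.mul_const _ ((Tendsto.mul ?_ ?_).mul ?_)
    · exact hlim.comp (tendsto_id.const_mul_atTop' (by norm_num))
    · exact hinv.comp (tendsto_atTop_add_const_right _ _ tendsto_natCast_atTop_atTop)
    · simp only [sub_eq_add_neg]
      exact hinv.comp (tendsto_atTop_add_const_right _ _ tendsto_natCast_atTop_atTop)
  · intro n j
    have hK0 : 0 ≤ K := (norm_nonneg _).trans (hK' 0)
    have hM0 : 0 ≤ M := (norm_nonneg _).trans (hM' 0)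
    simp only [norm_mul]
    gcongr
    exacts [hK' _, hM' _, hM' _]

/-- The bijection splitting pairs of integers by the parity of their sum. -/
theorem bijective_paritySplit :
    Function.Bijective (Sum.elim (fun q : ℤ × ℤ => (q.1 + q.2, q.1 - q.2))
      (fun q : ℤ × ℤ => (q.1 + q.2, q.1 - q.2 + 1))) := by
  constructor
  · rintro (⟨a, b⟩ | ⟨a, b⟩) (⟨c, d⟩ | ⟨c, d⟩) h <;>
      simp only [Sum.elim_inl, Sum.elim_inr, Prod.mk.injEq, Sum.inl.injEq, Sum.inr.injEq,
        reduceCtorEq] at h ⊢ <;> omega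
  · rintro ⟨m, n⟩
    rcases Int.even_or_odd' (m + n) with ⟨k, h | h⟩
    · exact ⟨Sum.inl (k, m - k), by simp; omega⟩
    · exact ⟨Sum.inr (k, m - k), by simp; omega⟩

theorem hasSum_mul_of_summable_norm {f g : ℤ → ℂ} (hf : Summable fun k => ‖f k‖)
    (hg : Summable fun k => ‖g k‖) :
    HasSum (fun q : ℤ × ℤ => f q.1 * g q.2) ((∑' k, f k) * ∑' k, g k) :=
  hf.of_norm.hasSum.mul hg.of_norm.hasSum (summable_mul_of_summable_norm hf hg)

theorem exists_thetaSeries_mul_eq {p : ℝ} (hp0 : 0 < p) (hp1 : p < 1) :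
    ∃ P Q : ℂ → ℂ, ∀ u v, thetaSeries p (u + v) * thetaSeries p (u - v) =
      Q u * P v - pPow p (u - v) * (P u * Q v) := by
  have hP : ∀ u, Summable fun k : ℤ => ‖pPow p ((k : ℂ) ^ 2 + 2 * k * u)‖ := fun u =>
    (summable_pPow_quadratic hp0 hp1 one_pos (2 * u)).congr fun k => by
      congr 2; push_cast; ring
  have hQ : ∀ u, Summable fun k : ℤ => ‖pPow p ((k : ℂ) ^ 2 - k + 2 * k * u)‖ := fun u =>
    (summable_pPow_quadratic hp0 hp1 one_pos (2 * u - 1)).congr fun k => by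
      congr 2; push_cast; ring
  refine ⟨fun u => ∑' k : ℤ, pPow p ((k : ℂ) ^ 2 + 2 * k * u),
    fun u => ∑' k : ℤ, pPow p ((k : ℂ) ^ 2 - k + 2 * k * u), fun u v => ?_⟩
  have h1 := hasSum_mul_of_summable_norm (hQ u) (hP v)
  have h2 := (hasSum_mul_of_summable_norm (hP u) (hQ v)).mul_left (-pPow p (u - v))
  have h := hasSum_mul_of_summable_norm (summable_norm_thetaTerm hp0 hp1 (u + v))
    (summable_norm_thetaTerm hp0 hp1 (u - v))
  rw [← (Equiv.ofBijective _ bijective_paritySplit).hasSum_iff] at h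
  rw [sub_eq_add_neg (_ * _), ← neg_mul]
  refine h.unique (HasSum.sum ?_ ?_)
  · convert! h1 using 1
    funext ⟨k, l⟩
    have hs : (-1 : ℂ) ^ (k + l) * (-1) ^ (k - l) = 1 := by
      rw [← zpow_add₀ (by norm_num), show k + l + (k - l) = 2 * k by ring]
      exact (even_two_mul k).neg_one_zpow
    simp only [Function.comp, Equiv.ofBijective_apply, Sum.elim_inl, thetaTerm]
    rw [mul_mul_mul_comm, hs, one_mul, ← pPow_add, ← pPow_add]
    congr 1
    push_cast
    ring
  · convert! h2 using 1
    funext ⟨k, l⟩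
    have hs : (-1 : ℂ) ^ (k + l) * (-1) ^ (k - l + 1) = -1 := by
      rw [← zpow_add₀ (by norm_num), show k + l + (k - l + 1) = 2 * k + 1 by ring]
      exact (odd_two_mul_add_one k).neg_one_zpow
    simp only [Function.comp, Equiv.ofBijective_apply, Sum.elim_inr, thetaTerm]
    rw [mul_mul_mul_comm, hs, neg_mul, neg_mul, one_mul, ← pPow_add, ← pPow_add, ← pPow_add]
    congr 2
    push_cast
    ring

theorem theta_pPow_neg {p : ℝ} (hp0 : 0 < p) (hp1 : p < 1) (w : ℂ) :
    theta p (pPow p (-w)) = -(pPow p w)⁻¹ * theta p (pPow p w) := by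
  obtain ⟨C, hC⟩ := exists_theta_eq_mul_thetaSeries hp0 hp1
  rw [hC, hC, thetaSeries_neg, pPow_neg]
  ring

/-- A degenerate case of Weierstrass' three-term relation for the theta function. -/
theorem theta_weierstrass {p : ℝ} (hp0 : 0 < p) (hp1 : p < 1) (a x y : ℂ) :
    theta p (pPow p a) ^ 2 * (theta p (pPow p (y + x)) * theta p (pPow p (y - x))) +
        pPow p (y - x) * (theta p (pPow p (a + y)) * theta p (pPow p (a - y))) *
          theta p (pPow p x) ^ 2 =
      theta p (pPow p (a + x)) * theta p (pPow p (a - x)) * theta p (pPow p y) ^ 2 := by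
  obtain ⟨C, hC⟩ := exists_theta_eq_mul_thetaSeries hp0 hp1
  obtain ⟨P, Q, h⟩ := exists_thetaSeries_mul_eq hp0 hp1
  have key : ∀ u v, theta p (pPow p (u + v)) * theta p (pPow p (u - v)) =
      C ^ 2 * (Q u * P v - pPow p u / pPow p v * (P u * Q v)) := fun u v => by
    rw [hC, hC, ← pPow_sub, ← h u v]
    ring
  have key0 : ∀ u, theta p (pPow p u) ^ 2 = C ^ 2 * (Q u * P 0 - pPow p u * (P u * Q 0)) :=
    fun u => by simpa [pPow_zero, sq] using key u 0
  have hx := pPow_ne_zero p x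
  have hy := pPow_ne_zero p y
  rw [key, key, key, key0, key0, key0, pPow_sub]
  field_simp
  ring

end ThetaSeries

section Unitarity

variable {p : ℝ} {κ x y : ℂ}

theorem Afun_mul_add_Bfun_mul (hp0 : 0 < p) (hp1 : p < 1)
    (h1 : theta p (pPow p (2 * κ + x)) ≠ 0) (h2 : theta p (pPow p (2 * κ - x)) ≠ 0)
    (hy : theta p (pPow p y) ≠ 0) :
    Afun p κ y x * Afun p κ y (-x) + Bfun p κ (-y) x * Bfun p κ y (-x) = 1 := by
  have hw := theta_weierstrass hp0 hp1 (2 * κ) x y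
  have ex := theta_pPow_neg hp0 hp1 x
  have ey := theta_pPow_neg hp0 hp1 y
  have hpx := pPow_ne_zero p x
  have hpy := pPow_ne_zero p y
  have hA : pPow p ((2 * κ - y) * x) * pPow p ((2 * κ - y) * -x) = 1 := by
    rw [← pPow_add, ← pPow_zero p]; ring_nf
  have hB : pPow p (2 * κ * (x - -y)) * pPow p (2 * κ * (-x - y)) = 1 := by
    rw [← pPow_add, ← pPow_zero p]; ring_nf
  simp only [Afun, Bfun, sub_neg_eq_add, neg_neg] at hB ⊢
  rw [mul_mul_mul_comm, hA, mul_mul_mul_comm, hB, ex, ey]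
  field_simp
  have hyx' : pPow p x * pPow p (y - x) = pPow p y := by rw [← pPow_add, add_sub_cancel]
  linear_combination pPow p x * hw - theta p (pPow p (2 * κ + y)) *
    theta p (pPow p (2 * κ - y)) * theta p (pPow p x) ^ 2 * hyx'

theorem Bfun_mul_add_Afun_mul (hp0 : 0 < p) (hp1 : p < 1)
    (h1 : theta p (pPow p (2 * κ + x)) ≠ 0) (h2 : theta p (pPow p (2 * κ - x)) ≠ 0)
    (hy : theta p (pPow p y) ≠ 0) :
    Bfun p κ y x * Afun p κ y (-x) + Afun p κ (-y) x * Bfun p κ y (-x) = 0 := by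
  have ex := theta_pPow_neg hp0 hp1 x
  have ey := theta_pPow_neg hp0 hp1 y
  have exy := theta_pPow_neg hp0 hp1 (y + x)
  have hpx := pPow_ne_zero p x
  have hpy := pPow_ne_zero p y
  have hE : pPow p (2 * κ * (x - y)) * pPow p ((2 * κ - y) * -x) =
      pPow p ((2 * κ - -y) * x) * pPow p (2 * κ * (-x - y)) := by
    rw [← pPow_add, ← pPow_add]; ring_nf
  simp only [Afun, Bfun, sub_neg_eq_add, neg_neg, show -y - x = -(y + x) by ring] at hE ⊢
  rw [mul_mul_mul_comm, hE, mul_mul_mul_comm, ex, ey, exy, pPow_add p y x]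
  field_simp
  ring

theorem sgn3_mul_self (i : Fin 3) : sgn3 i * sgn3 i = 1 := by
  unfold sgn3
  split_ifs <;> norm_num

theorem cfun_ne_zero (h : theta p (pPow p x) ≠ 0) (h' : theta p (pPow p (2 * κ + x)) ≠ 0) :
    cfun p κ x ≠ 0 :=
  div_ne_zero (mul_ne_zero (pPow_ne_zero _ _) h') h

theorem cfun_ratio_mul (hx : cfun p κ x ≠ 0) (hx' : cfun p κ (-x) ≠ 0) (i : Fin 3) :
    sgn3 i * (cfun p κ x / cfun p κ (sgn3 i * x)) *
      (sgn3 i * (cfun p κ (-x) / cfun p κ (sgn3 i * -x))) = 1 := by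
  unfold sgn3
  split_ifs
  · simp only [neg_one_mul, neg_neg]
    field_simp
  · simp only [one_mul]
    field_simp

end Unitarity

/-- **Unitarity of the elliptic dynamical `R`-matrix**:
for all admissible `x ∈ ℂ` and `φ ∈ ℂ³`, `R(x;φ) ∘ R(−x;φ) = Id` on `V ⊗ V`. -/
theorem unitarity_of_R (p : ℝ) (hp0 : 0 < p) (hp1 : p < 1) (κ : ℂ)
    (x : ℂ) (φ : Fin 3 → ℂ)
    (hadm : RAdm p κ x φ ∧ RAdm p κ (-x) φ) :
    Rop p κ x φ * Rop p κ (-x) φ = 1 := by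
  obtain ⟨⟨hx, hκx, hκx', hφ⟩, hnx, hnκx, -, -⟩ := hadm
  ext ab ⟨i, j⟩
  rw [Matrix.mul_apply]
  by_cases hij : i = j
  · subst hij
    have hc := cfun_ratio_mul (cfun_ne_zero hx hκx) (cfun_ne_zero hnx hnκx) i
    simp only [Rop, if_true, mul_ite, mul_zero, Finset.sum_ite_eq', Finset.mem_univ,
      Matrix.one_apply, ite_mul, zero_mul, hc]
  · have hji : ¬ j = i := fun h => hij h.symm
    have h1 := Afun_mul_add_Bfun_mul hp0 hp1 hκx hκx' (hφ i j hij)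
    have h2 := Bfun_mul_add_Afun_mul hp0 hp1 hκx hκx' (hφ i j hij)
    rw [neg_sub] at h1 h2
    have hs := sgn3_mul_self i
    have hs' := sgn3_mul_self j
    have hne : ((i, j) : Fin 3 × Fin 3) ≠ (j, i) := fun h => hij (congrArg Prod.fst h)
    simp only [Rop, if_neg hij, mul_add, mul_ite, mul_zero, Finset.sum_add_distrib,
      Finset.sum_ite_eq', Finset.mem_univ, if_true, if_neg hji, Matrix.one_apply]
    by_cases hab : ab = (i, j)
    · subst hab
      simp only [if_true, if_neg hne]
      linear_combination h1 + Bfun p κ (φ j - φ i) x * Bfun p κ (φ i - φ j) (-x) *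
        (sgn3 j * sgn3 j * hs + hs')
    · simp only [if_neg hab]
      split_ifs
      · linear_combination sgn3 i * sgn3 j * h2
      · ring

end
end

section
/- The operator B on ℂ³ ⊗ ℂ³ satisfies the braid relation B₁₂ B₂₃ B₁₂ = B₂₃ B₁₂ B₂₃ as linear operators on ℂ³ ⊗ ℂ³ ⊗ ℂ³, and the Hecke relation (B − q·Id)(B + q⁻¹·Id) = 0 on ℂ³ ⊗ ℂ³. -/
noncomputable section

/-- The braid operator `B` on `ℂ³ ⊗ ℂ³` obtained from the universal `R`-matrix of
`U_q(gl(2|1))` on the tensor square of its vector representation, as a matrix with respect to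
the basis `v_i ⊗ v_j` (the pair `(i,j)` indexes the column, i.e. the input):
`B(v_i ⊗ v_i) = q·v_i ⊗ v_i` for `i = 1,2`, `B(v₃ ⊗ v₃) = −q⁻¹·v₃ ⊗ v₃`; for `i < j`:
`B(v_i ⊗ v_j) = (q − q⁻¹)·v_i ⊗ v_j + (−1)^{p(i)+p(j)}·v_j ⊗ v_i` and
`B(v_j ⊗ v_i) = (−1)^{p(i)+p(j)}·v_i ⊗ v_j`. -/
def Bop (q : ℂ) : Matrix (Fin 3 × Fin 3) (Fin 3 × Fin 3) ℂ := fun ab ij =>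
  if ij.1 = ij.2 then
    (if ab = ij then (if ij.1 = 2 then -q⁻¹ else q) else 0)
  else if ij.1 < ij.2 then
    (if ab = ij then q - q⁻¹ else 0) +
      (if ab = (ij.2, ij.1) then sgn3 ij.1 * sgn3 ij.2 else 0)
  else
    (if ab = (ij.2, ij.1) then sgn3 ij.1 * sgn3 ij.2 else 0)

/-- For a matrix `M` on `ℂ³ ⊗ ℂ³`, the matrix `M₁₂ = M ⊗ Id` on `ℂ³ ⊗ ℂ³ ⊗ ℂ³`. -/
def leg12 (M : Matrix (Fin 3 × Fin 3) (Fin 3 × Fin 3) ℂ) :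
    Matrix (Fin 3 × Fin 3 × Fin 3) (Fin 3 × Fin 3 × Fin 3) ℂ := fun a b =>
  if a.2.2 = b.2.2 then M (a.1, a.2.1) (b.1, b.2.1) else 0

/-- For a matrix `M` on `ℂ³ ⊗ ℂ³`, the matrix `M₂₃ = Id ⊗ M` on `ℂ³ ⊗ ℂ³ ⊗ ℂ³`. -/
def leg23 (M : Matrix (Fin 3 × Fin 3) (Fin 3 × Fin 3) ℂ) :
    Matrix (Fin 3 × Fin 3 × Fin 3) (Fin 3 × Fin 3 × Fin 3) ℂ := fun a b =>
  if a.1 = b.1 then M (a.2.1, a.2.2) (b.2.1, b.2.2) else 0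

open scoped Matrix

/-- The coefficient of `v_i ⊗ v_j` in `B(v_i ⊗ v_j)`. -/
def diagCoeff (q : ℂ) (i j : Fin 3) : ℂ :=
  if i = j then (if i = 2 then -q⁻¹ else q) else if i < j then q - q⁻¹ else 0

/-- The coefficient of `v_j ⊗ v_i` in `B(v_i ⊗ v_j)` for `i ≠ j`, and zero for `i = j`. -/
def swapCoeff (i j : Fin 3) : ℂ := if i = j then 0 else sgn3 i * sgn3 j

theorem Bop_apply (q : ℂ) (a b i j : Fin 3) :
    Bop q (a, b) (i, j) = diagCoeff q i j * (if a = i ∧ b = j then 1 else 0) +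
      swapCoeff i j * (if a = j ∧ b = i then 1 else 0) := by
  unfold Bop diagCoeff swapCoeff
  simp only [Prod.mk.injEq]
  split_ifs <;> simp

theorem Bop_mulVec_single (q : ℂ) (i j : Fin 3) :
    Bop q *ᵥ Pi.single (i, j) 1 =
      diagCoeff q i j • Pi.single (i, j) 1 + swapCoeff i j • Pi.single (j, i) 1 := by
  ext ⟨a, b⟩
  simp [Bop_apply, Pi.single_apply]

theorem leg12_Bop_mulVec_single (q : ℂ) (i j k : Fin 3) :
    leg12 (Bop q) *ᵥ Pi.single (i, j, k) 1 =
      diagCoeff q i j • Pi.single (i, j, k) 1 + swapCoeff i j • Pi.single (j, i, k) 1 := by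
  ext ⟨a, b, c⟩
  by_cases h : c = k <;> simp [leg12, Bop_apply, Pi.single_apply, h]

theorem leg23_Bop_mulVec_single (q : ℂ) (i j k : Fin 3) :
    leg23 (Bop q) *ᵥ Pi.single (i, j, k) 1 =
      diagCoeff q j k • Pi.single (i, j, k) 1 + swapCoeff j k • Pi.single (i, k, j) 1 := by
  ext ⟨a, b, c⟩
  by_cases h : a = i <;> simp [leg23, Bop_apply, Pi.single_apply, h]

/-- **The `U_q(gl(2|1))` braid operator satisfies the braid and Hecke relations**:
`B₁₂ B₂₃ B₁₂ = B₂₃ B₁₂ B₂₃` on `ℂ³ ⊗ ℂ³ ⊗ ℂ³` and `(B − q·Id)(B + q⁻¹·Id) = 0` on `ℂ³ ⊗ ℂ³`. -/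
theorem Bop_braid_and_hecke (q : ℂ) (hq : q ≠ 0) :
    leg12 (Bop q) * leg23 (Bop q) * leg12 (Bop q) =
        leg23 (Bop q) * leg12 (Bop q) * leg23 (Bop q) ∧
      (Bop q - q • 1) * (Bop q + q⁻¹ • 1) = 0 := by
  constructor
  · refine Matrix.ext_of_mulVec_single fun ⟨i, j, k⟩ => ?_
    simp only [← Matrix.mulVec_mulVec, Matrix.mulVec_add, Matrix.mulVec_smul,
      leg12_Bop_mulVec_single, leg23_Bop_mulVec_single]
    fin_cases i <;> fin_cases j <;> fin_cases k <;>
      simp [diagCoeff, swapCoeff, sgn3] <;> match_scalars <;> field_simp <;> ring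
  · refine Matrix.ext_of_mulVec_single fun ⟨i, j⟩ => ?_
    simp only [← Matrix.mulVec_mulVec, Matrix.add_mulVec, Matrix.sub_mulVec, Matrix.smul_mulVec,
      Matrix.one_mulVec, Matrix.zero_mulVec, Matrix.mulVec_add, Matrix.mulVec_smul,
      Bop_mulVec_single]
    fin_cases i <;> fin_cases j <;>
      simp [diagCoeff, swapCoeff, sgn3] <;> match_scalars <;> field_simp <;> ring

end
end
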